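/- arXiv:1709.09623 — 3 statements merged into one kernel-verified Lean document; each statement's English description precedes it below -/
import Mathlib

section
/- Application of a consistent trace is idempotent: for every base security type t and every consistent permission trace Λ (each permission occurs at most once in Λ), (t·Λ)·Λ = t·Λ. -/
/-- A signed permission (literal): `⊕p` or `⊖p`. -/
inductive SPerm (Perm : Type*) where
  | pos : Perm → SPerm Perm
  | neg : Perm → SPerm Perm

/-- The underlying permission of a literal. -/
def SPerm.perm {Perm : Type*} : SPerm Perm → Perm
  | .pos p => p
  | .neg p => p

/-- Promotion of a base security type at permission `p`. -/
def promote {Perm : Type*} [DecidableEq Perm] {L : Type*} [Lattice L]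
    (t : Finset Perm → L) (p : Perm) : Finset Perm → L :=
  fun P => t (P ∪ {p})

/-- Demotion of a base security type at permission `p`. -/
def demote {Perm : Type*} [DecidableEq Perm] {L : Type*} [Lattice L]
    (t : Finset Perm → L) (p : Perm) : Finset Perm → L :=
  fun P => t (P \ {p})

/-- Application of a permission trace (list of literals) to a base security type. -/
def applyTrace {Perm : Type*} [DecidableEq Perm] {L : Type*} [Lattice L] :
    (Finset Perm → L) → List (SPerm Perm) → (Finset Perm → L)
  | t, [] => t
  | t, .pos p :: Λ => applyTrace (promote t p) Λ
  | t, .neg p :: Λ => applyTrace (demote t p) Λ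

theorem promote_promote_self {Perm : Type*} [DecidableEq Perm] {L : Type*} [Lattice L]
    (t : Finset Perm → L) (p : Perm) : promote (promote t p) p = promote t p := by
  funext P
  simp [promote]

theorem demote_demote_self {Perm : Type*} [DecidableEq Perm] {L : Type*} [Lattice L]
    (t : Finset Perm → L) (p : Perm) : demote (demote t p) p = demote t p := by
  funext P
  simp [demote]

theorem promote_comm {Perm : Type*} [DecidableEq Perm] {L : Type*} [Lattice L]
    (t : Finset Perm → L) (p q : Perm) :
    promote (promote t p) q = promote (promote t q) p := by
  funext P
  simp only [promote, Finset.union_right_comm]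

theorem demote_comm {Perm : Type*} [DecidableEq Perm] {L : Type*} [Lattice L]
    (t : Finset Perm → L) (p q : Perm) :
    demote (demote t p) q = demote (demote t q) p := by
  funext P
  simp only [demote, sdiff_right_comm]

theorem promote_demote_comm {Perm : Type*} [DecidableEq Perm] {L : Type*} [Lattice L]
    (t : Finset Perm → L) {p q : Perm} (h : p ≠ q) :
    promote (demote t p) q = demote (promote t q) p := by
  funext P
  simp only [promote, demote]
  congr 1
  grind

theorem applyTrace_promote {Perm : Type*} [DecidableEq Perm] {L : Type*} [Lattice L]
    (t : Finset Perm → L) {p : Perm} {Λ : List (SPerm Perm)} (h : p ∉ Λ.map SPerm.perm) :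
    applyTrace (promote t p) Λ = promote (applyTrace t Λ) p := by
  induction Λ generalizing t with
  | nil => rfl
  | cons s Λ ih =>
    obtain ⟨hne, hΛ⟩ := not_or.mp (List.mem_cons.not.mp h)
    cases s with
    | pos q => rw [applyTrace, promote_comm, ih _ hΛ, applyTrace]
    | neg q => rw [applyTrace, ← promote_demote_comm (p := q) t (Ne.symm hne), ih _ hΛ, applyTrace]

theorem applyTrace_demote {Perm : Type*} [DecidableEq Perm] {L : Type*} [Lattice L]
    (t : Finset Perm → L) {p : Perm} {Λ : List (SPerm Perm)} (h : p ∉ Λ.map SPerm.perm) :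
    applyTrace (demote t p) Λ = demote (applyTrace t Λ) p := by
  induction Λ generalizing t with
  | nil => rfl
  | cons s Λ ih =>
    obtain ⟨hne, hΛ⟩ := not_or.mp (List.mem_cons.not.mp h)
    cases s with
    | pos q => rw [applyTrace, promote_demote_comm (q := q) t hne, ih _ hΛ, applyTrace]
    | neg q => rw [applyTrace, demote_comm, ih _ hΛ, applyTrace]

theorem applyTrace_idem {Perm : Type*} [DecidableEq Perm] {L : Type*} [Lattice L]
    (t : Finset Perm → L) (Λ : List (SPerm Perm))
    (hconsistent : (Λ.map SPerm.perm).Nodup) :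
    applyTrace (applyTrace t Λ) Λ = applyTrace t Λ := by
  induction Λ generalizing t with
  | nil => rfl
  | cons s Λ ih =>
    obtain ⟨hp, hΛ⟩ := List.nodup_cons.mp hconsistent
    cases s with
    | pos p =>
      simp only [applyTrace]
      rw [← applyTrace_promote (p := p) _ hp, promote_promote_self, ih _ hΛ]
    | neg p =>
      simp only [applyTrace]
      rw [← applyTrace_demote (p := p) _ hp, demote_demote_self, ih _ hΛ]
end

section
/- Trace application distributes over merging along a permission not occurring in the trace: for all base security types s, t, every permission p, and every permission trace Λ with p ∉ Λ, (p ▷ (s, t))·Λ = p ▷ (s·Λ, t·Λ). -/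
/-- Merging of two base security types along permission `p`. -/
def merge {Perm : Type*} [DecidableEq Perm] {L : Type*} [Lattice L]
    (p : Perm) (t₁ t₂ : Finset Perm → L) : Finset Perm → L :=
  fun P => if p ∈ P then t₁ P else t₂ P

theorem promote_merge {Perm : Type*} [DecidableEq Perm] {L : Type*} [Lattice L]
    (s t : Finset Perm → L) {p q : Perm} (h : p ≠ q) :
    promote (merge p s t) q = merge p (promote s q) (promote t q) := by
  funext P
  simp [promote, merge, h]

theorem demote_merge {Perm : Type*} [DecidableEq Perm] {L : Type*} [Lattice L]
    (s t : Finset Perm → L) {p q : Perm} (h : p ≠ q) :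
    demote (merge p s t) q = merge p (demote s q) (demote t q) := by
  funext P
  simp [demote, merge, h]

theorem applyTrace_merge {Perm : Type*} [DecidableEq Perm] {L : Type*} [Lattice L]
    (s t : Finset Perm → L) (p : Perm) (Λ : List (SPerm Perm))
    (h : p ∉ Λ.map SPerm.perm) :
    applyTrace (merge p s t) Λ = merge p (applyTrace s Λ) (applyTrace t Λ) := by
  induction Λ generalizing s t with
  | nil => rfl
  | cons a Λ ih =>
    rw [List.map_cons, List.mem_cons, not_or] at h
    cases a with
    | pos q => rw [applyTrace, promote_merge s t (q := q) h.1, ih _ _ h.2]; rfl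
    | neg q => rw [applyTrace, demote_merge s t (q := q) h.1, ih _ _ h.2]; rfl
end

section
/- Subtyping of base security types is equivalent to subtyping of both the promotion and the demotion: for all base security types s, t and every permission p, s ≤ t if and only if s↑p ≤ t↑p and s↓p ≤ t↓p (equivalently, s·[⊕p] ≤ t·[⊕p] and s·[⊖p] ≤ t·[⊖p]). -/
theorem le_iff_promote_le_and_demote_le {Perm : Type*} [DecidableEq Perm]
    {L : Type*} [Lattice L] (s t : Finset Perm → L) (p : Perm) :
    s ≤ t ↔ promote s p ≤ promote t p ∧ demote s p ≤ demote t p := by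
  refine ⟨fun h => ⟨fun P => h (P ∪ {p}), fun P => h (P \ {p})⟩, fun ⟨hpro, hdem⟩ P => ?_⟩
  by_cases hp : p ∈ P
  · have hP : P ∪ {p} = P := Finset.union_eq_left.2 (Finset.singleton_subset_iff.2 hp)
    simpa only [promote, hP] using hpro P
  · have hP : P \ {p} = P := Finset.sdiff_eq_self_of_disjoint (Finset.disjoint_singleton_right.2 hp)
    simpa only [demote, hP] using hdem P
end
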